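/- arXiv:2110.14468 — 2 statements merged into one kernel-verified Lean document; each statement's English description precedes it below -/
import Mathlib

section
/- The optimal value dominates the value of every stationary policy: letting v* be the unique fixed point of the Bellman optimality operator T and, for each deterministic stationary policy μ : S → A, letting v^μ be the unique fixed point of T_μ, one has v^μ s ≤ v* s for every s ∈ S and every μ. -/
/-- The optimal value dominates the value of every deterministic stationary policy:
`v^μ s ≤ v* s` for every state `s` and every policy `μ`, where `v*` is the fixed point of
the Bellman optimality operator and `v^μ` the fixed point of the policy Bellman operator. -/
theorem optimal_value_dominates_policy_values
    {S A : Type*} [Fintype S] [Nonempty S] [Fintype A] [Nonempty A]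
    (P : S → A → S → ℝ) (hP0 : ∀ s a s', 0 ≤ P s a s') (hP1 : ∀ s a, ∑ s', P s a s' = 1)
    (r : S → A → ℝ) (γ : ℝ) (hγ0 : 0 ≤ γ) (hγ1 : γ < 1)
    (vstar : S → ℝ)
    (hvstar : ∀ s, vstar s = ⨆ a : A, (r s a + γ * ∑ s', P s a s' * vstar s')) :
    ∀ (μ : S → A) (vμ : S → ℝ),
      (∀ s, vμ s = r s (μ s) + γ * ∑ s', P s (μ s) s' * vμ s') →
      ∀ s, vμ s ≤ vstar s := by
  intro μ v hv s
  obtain ⟨t, ht⟩ := Finite.exists_max fun s => v s - vstar s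
  have h_sup : r t (μ t) + γ * ∑ s', P t (μ t) s' * vstar s' ≤ vstar t := by
    rw [hvstar t]
    exact le_ciSup (f := fun a => r t a + γ * ∑ s', P t a s' * vstar s')
      (Set.finite_range _).bddAbove (μ t)
  have h_avg : ∑ s', P t (μ t) s' * v s' - ∑ s', P t (μ t) s' * vstar s' ≤ v t - vstar t := by
    calc
      _ = ∑ s', P t (μ t) s' * (v s' - vstar s') := by
        simp only [mul_sub, Finset.sum_sub_distrib]
      _ ≤ ∑ s', P t (μ t) s' * (v t - vstar t) :=
        Finset.sum_le_sum fun s' _ => mul_le_mul_of_nonneg_left (ht s') (hP0 _ _ _)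
      _ = v t - vstar t := by rw [← Finset.sum_mul, hP1, one_mul]
  have h_contr := mul_le_mul_of_nonneg_left h_avg hγ0
  have h_max : v t - vstar t ≤ 0 := by
    by_contra! h_pos
    nlinarith [hv t, mul_pos (sub_pos.2 hγ1) h_pos]
  linarith [ht s]
end

section
/- Greedy policies are optimal: let v* be the unique fixed point of the Bellman optimality operator T, and let μ* : S → A be any policy such that for every s ∈ S, r s (μ* s) + γ · ∑_{s'} P s (μ* s) s' · v* s' = max_{a ∈ A} (r s a + γ · ∑_{s'} P s a s' · v* s'). Then the unique fixed point v^{μ*} of T_{μ*} equals v*; in particular v^{μ*} s ≥ v^μ s for every s and every deterministic stationary policy μ. -/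
/-- Comparison principle for discounted affine operators: a subsolution of `v = c + γ Q v`, with
`Q` row-stochastic, lies below every supersolution. -/
theorem le_of_discounted_subsolution_of_supersolution
    {S : Type*} [Fintype S] {Q : S → S → ℝ} (hQ0 : ∀ s s', 0 ≤ Q s s')
    (hQ1 : ∀ s, ∑ s', Q s s' = 1) {γ : ℝ} (hγ0 : 0 ≤ γ) (hγ1 : γ < 1) {c u v : S → ℝ}
    (hu : ∀ s, u s ≤ c s + γ * ∑ s', Q s s' * u s')
    (hv : ∀ s, c s + γ * ∑ s', Q s s' * v s' ≤ v s) (s : S) : u s ≤ v s := by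
  have : Nonempty S := ⟨s⟩
  obtain ⟨m, hm⟩ := Finite.exists_max fun t => u t - v t
  have hsum : ∑ s', Q m s' * u s' - ∑ s', Q m s' * v s' ≤ u m - v m :=
    calc ∑ s', Q m s' * u s' - ∑ s', Q m s' * v s'
        = ∑ s', Q m s' * (u s' - v s') := by simp only [mul_sub, Finset.sum_sub_distrib]
      _ ≤ ∑ s', Q m s' * (u m - v m) :=
          Finset.sum_le_sum fun t _ => mul_le_mul_of_nonneg_left (hm t) (hQ0 m t)
      _ = u m - v m := by rw [← Finset.sum_mul, hQ1, one_mul]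
  have hscaled := mul_le_mul_of_nonneg_left hsum hγ0
  have hmax : u m - v m ≤ 0 := by
    by_contra! hpos
    nlinarith [hu m, hv m]
  linarith [hm s]

/-- Greedy policies are optimal: if `μ*` is greedy with respect to the optimal value `v*`
(the unique fixed point of the Bellman optimality operator), then the value `v^{μ*}` of
`μ*` equals `v*`; in particular `v^{μ*}` dominates the value of every policy. -/
theorem greedy_policy_is_optimal
    {S A : Type*} [Fintype S] [Nonempty S] [Fintype A] [Nonempty A]
    (P : S → A → S → ℝ) (hP0 : ∀ s a s', 0 ≤ P s a s') (hP1 : ∀ s a, ∑ s', P s a s' = 1)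
    (r : S → A → ℝ) (γ : ℝ) (hγ0 : 0 ≤ γ) (hγ1 : γ < 1)
    (vstar : S → ℝ)
    (hvstar : ∀ s, vstar s = ⨆ a : A, (r s a + γ * ∑ s', P s a s' * vstar s'))
    (μstar : S → A)
    (hgreedy : ∀ s, r s (μstar s) + γ * ∑ s', P s (μstar s) s' * vstar s'
        = ⨆ a : A, (r s a + γ * ∑ s', P s a s' * vstar s'))
    (vμstar : S → ℝ)
    (hvμstar : ∀ s, vμstar s = r s (μstar s) + γ * ∑ s', P s (μstar s) s' * vμstar s') :
    vμstar = vstar ∧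
    ∀ (μ : S → A) (vμ : S → ℝ),
      (∀ s, vμ s = r s (μ s) + γ * ∑ s', P s (μ s) s' * vμ s') →
      ∀ s, vμ s ≤ vμstar s := by
  have hfix : ∀ s, vstar s = r s (μstar s) + γ * ∑ s', P s (μstar s) s' * vstar s' :=
    fun s => (hvstar s).trans (hgreedy s).symm
  have heq : vμstar = vstar := funext fun s => le_antisymm
    (le_of_discounted_subsolution_of_supersolution (fun s => hP0 s (μstar s))
      (fun s => hP1 s (μstar s)) hγ0 hγ1 (fun s => (hvμstar s).le) (fun s => (hfix s).ge) s)
    (le_of_discounted_subsolution_of_supersolution (fun s => hP0 s (μstar s))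
      (fun s => hP1 s (μstar s)) hγ0 hγ1 (fun s => (hfix s).le) (fun s => (hvμstar s).ge) s)
  refine ⟨heq, fun μ vμ hμ s => ?_⟩
  rw [heq]
  refine le_of_discounted_subsolution_of_supersolution (fun s => hP0 s (μ s))
    (fun s => hP1 s (μ s)) hγ0 hγ1 (fun s => (hμ s).le) (fun s => ?_) s
  exact (le_ciSup (f := fun a => r s a + γ * ∑ s', P s a s' * vstar s')
    (Set.finite_range _).bddAbove (μ s)).trans (hvstar s).ge
end
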